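/- For every smooth E-valued random variable F ∈ S(Ω) ⊗ E and every h ∈ H, the expectation of the Malliavin derivative in direction h equals E(W(h)F), i.e. E(DF(h)) = E(W(h)F). -/

import Mathlib

open MeasureTheory ProbabilityTheory Filter
open scoped ENNReal NNReal RealInnerProductSpace

/-- `W` is an isonormal Gaussian process on `H` over `(Ω,P)`: `W` is (a.e.) linear in `h`
and each `W h` is a centred Gaussian with variance `‖h‖²`; by polarization this encodes
`E(W h₁ · W h₂) = ⟪h₁,h₂⟫`. -/
def IsIsonormal {Ω H : Type*} [MeasurableSpace Ω]
    [NormedAddCommGroup H] [InnerProductSpace ℝ H]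
    (P : Measure Ω) (W : H → Ω → ℝ) : Prop :=
  (∀ h, AEMeasurable (W h) P) ∧
  (∀ h, P.map (W h) = gaussianReal 0 (‖h‖₊ ^ 2)) ∧
  (∀ h₁ h₂, W (h₁ + h₂) =ᵐ[P] W h₁ + W h₂) ∧
  (∀ (c : ℝ) (h), W (c • h) =ᵐ[P] c • W h)


/-- `f ∈ C_b^∞(ℝⁿ)`: a smooth function which is bounded and has bounded derivatives
of all orders. -/
def CbSmooth {n : ℕ} (f : (Fin n → ℝ) → ℝ) : Prop :=
  ContDiff ℝ (⊤ : ℕ∞) f ∧ ∀ m : ℕ, ∃ C, ∀ y, ‖iteratedFDeriv ℝ m f y‖ ≤ C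


/-- **Stein's lemma**: Gaussian integration by parts for a centred real Gaussian. -/
lemma integral_id_mul_gaussianReal {v : ℝ≥0} {g g' : ℝ → ℝ} (hg : ∀ y, HasDerivAt g (g' y) y)
    (hg' : Continuous g') {C C' : ℝ} (hC : ∀ y, |g y| ≤ C) (hC' : ∀ y, |g' y| ≤ C') :
    ∫ y, y * g y ∂gaussianReal 0 v = v * ∫ y, g' y ∂gaussianReal 0 v := by
  rcases eq_or_ne v 0 with rfl | hv
  · simp [gaussianReal_zero_var]
  have hv' : (v : ℝ) ≠ 0 := by exact_mod_cast hv
  have hgc : Continuous g := continuous_iff_continuousAt.2 fun y => (hg y).continuousAt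
  have hpdf : ∀ y, HasDerivAt (gaussianPDFReal 0 v) (-(y / v) * gaussianPDFReal 0 v y) y := by
    intro y
    have h1 : HasDerivAt (fun y : ℝ => -(y - 0) ^ 2 / (2 * v)) (-(y / v)) y := by
      have := ((((hasDerivAt_id y).sub_const 0).pow 2).neg).div_const (2 * (v : ℝ))
      convert! this using 1
      simp
      field_simp
    have h2 := (h1.exp).const_mul (√(2 * Real.pi * v))⁻¹
    convert! h2 using 1
    simp only [gaussianPDFReal]
    ring
  have hint : Integrable (gaussianPDFReal 0 v) := integrable_gaussianPDFReal 0 v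
  have hint_id : Integrable (fun y => y * gaussianPDFReal 0 v y) := by
    have h1 : Integrable (fun y : ℝ => y) (gaussianReal 0 v) :=
      (memLp_id_gaussianReal (μ := 0) (v := v) 1).integrable (by simp)
    rw [gaussianReal_of_var_ne_zero _ hv,
      integrable_withDensity_iff (measurable_gaussianPDF 0 v) (by simp [gaussianPDF])] at h1
    simpa [toReal_gaussianPDF] using h1
  have key := integral_mul_deriv_eq_deriv_mul_of_integrable (u := g) (u' := g')
    (v := gaussianPDFReal 0 v) (v' := fun y => -(y / v) * gaussianPDFReal 0 v y)
    (fun y _ => hg y) (fun y _ => hpdf y) ?_ ?_ ?_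
  · rw [integral_gaussianReal_eq_integral_smul hv, integral_gaussianReal_eq_integral_smul hv]
    simp only [smul_eq_mul]
    have e1 : ∫ y, gaussianPDFReal 0 v y * (y * g y)
        = -(v * ∫ y, g y * (-(y / v) * gaussianPDFReal 0 v y)) := by
      rw [← integral_const_mul, ← integral_neg]
      congr 1 with y
      field_simp
    rw [e1, key, mul_neg, neg_neg]
    simp only [mul_comm]
  · have := (hint_id.const_mul (-(v : ℝ)⁻¹)).bdd_mul (c := C) hgc.aestronglyMeasurable
      (Eventually.of_forall hC)
    convert! this using 2 with y
    simp only [Pi.mul_apply]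
    ring
  · exact hint.bdd_mul (c := C') hg'.aestronglyMeasurable (Eventually.of_forall hC')
  · exact hint.bdd_mul (c := C) hgc.aestronglyMeasurable (Eventually.of_forall hC)

lemma ContinuousLinearMap.apply_eq_sum_single_mul {ι : Type*} [Fintype ι] [DecidableEq ι]
    (L : (ι → ℝ) →L[ℝ] ℝ) (c : ι → ℝ) : L c = ∑ j, L (Pi.single j 1) * c j := by
  conv_lhs => rw [← Finset.univ_sum_single c, map_sum]
  refine Finset.sum_congr rfl fun j _ => ?_
  rw [← mul_one (c j), ← smul_eq_mul, Pi.single_smul, map_smul]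
  simp [mul_comm]

namespace IsIsonormal

variable {Ω H : Type*} [MeasurableSpace Ω] [NormedAddCommGroup H] [InnerProductSpace ℝ H]
  {P : Measure Ω} {W : H → Ω → ℝ}

lemma map_zero (hW : IsIsonormal P W) : W 0 =ᵐ[P] 0 := by
  simpa using hW.2.2.2 0 0

lemma map_sum_smul (hW : IsIsonormal P W) {ι : Type*} (s : Finset ι) (c : ι → ℝ) (g : ι → H) :
    W (∑ j ∈ s, c j • g j) =ᵐ[P] fun ω => ∑ j ∈ s, c j * W (g j) ω := by
  classical
  induction s using Finset.induction_on with
  | empty => simpa using! hW.map_zero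
  | insert a s ha ih =>
    filter_upwards [hW.2.2.1 (c a • g a) (∑ j ∈ s, c j • g j), hW.2.2.2 (c a) (g a), ih]
      with ω h1 h2 h3
    simp [Finset.sum_insert ha, h1, h2, h3]

lemma dual_comp (hW : IsIsonormal P W) {ι : Type*} [Fintype ι] [DecidableEq ι] (g : ι → H)
    (L : (ι → ℝ) →L[ℝ] ℝ) :
    (fun ω => L fun j => W (g j) ω) =ᵐ[P] W (∑ j, L (Pi.single j 1) • g j) := by
  filter_upwards [hW.map_sum_smul Finset.univ (fun j => L (Pi.single j 1)) g] with ω hω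
  rw [hω, L.apply_eq_sum_single_mul]

lemma hasGaussianLaw (hW : IsIsonormal P W) (h : H) : HasGaussianLaw (W h) P where
  isGaussian_map := by rw [hW.2.1 h]; infer_instance

lemma hasGaussianLaw_pi (hW : IsIsonormal P W) {ι : Type*} [Fintype ι] (g : ι → H) :
    HasGaussianLaw (fun ω j => W (g j) ω) P where
  isGaussian_map := by
    classical
    have hm : AEMeasurable (fun ω j => W (g j) ω) P := aemeasurable_pi_lambda _ fun j => hW.1 (g j)
    refine isGaussian_of_map_eq_gaussianReal fun L =>
      ⟨0, ‖∑ j, L (Pi.single j 1) • g j‖₊ ^ 2, ?_⟩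
    rw [AEMeasurable.map_map_of_aemeasurable (by fun_prop) hm, ← hW.2.1]
    exact Measure.map_congr (hW.dual_comp g L)

lemma variance_eq (hW : IsIsonormal P W) (h : H) : Var[W h; P] = ‖h‖ ^ 2 := by
  have h1 : Var[fun y => y; P.map (W h)] = Var[W h; P] :=
    variance_map (X := fun y : ℝ => y) (by fun_prop) (hW.1 h)
  rw [← h1, hW.2.1, variance_fun_id_gaussianReal]
  simp

lemma covariance_eq [IsProbabilityMeasure P] (hW : IsIsonormal P W) (h₁ h₂ : H) :
    cov[W h₁, W h₂; P] = ⟪h₁, h₂⟫ := by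
  have h1 := variance_add (hW.hasGaussianLaw h₁).memLp_two (hW.hasGaussianLaw h₂).memLp_two
  rw [← variance_congr (hW.2.2.1 h₁ h₂), hW.variance_eq, hW.variance_eq, hW.variance_eq,
    norm_add_sq_real] at h1
  linarith

lemma indepFun_pi [IsProbabilityMeasure P] (hW : IsIsonormal P W) {ι : Type*} [Fintype ι]
    (k : H) (g : ι → H) (hg : ∀ j, ⟪k, g j⟫ = 0) :
    IndepFun (W k) (fun ω j => W (g j) ω) P := by
  classical
  have hG : HasGaussianLaw (fun ω => (W k ω, fun j => W (g j) ω)) P :=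
    (hW.hasGaussianLaw_pi fun j : Option ι => j.elim k g).map
      ((ContinuousLinearMap.proj none).prod
        (ContinuousLinearMap.pi fun j => ContinuousLinearMap.proj (some j)))
  refine hG.indepFun_of_covariance_strongDual fun L₁ L₂ => ?_
  have h1 : L₁ ∘ W k =ᵐ[P] W (L₁ 1 • k) := by
    filter_upwards [hW.2.2.2 (L₁ 1) k] with ω hω
    rw [hω, Function.comp_apply, ← mul_one (W k ω), ← smul_eq_mul, L₁.map_smul]
    simp [mul_comm]
  have h2 : L₂ ∘ (fun ω j => W (g j) ω) =ᵐ[P] W (∑ j, L₂ (Pi.single j 1) • g j) :=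
    hW.dual_comp g L₂
  have h3 : cov[L₁ ∘ W k, L₂ ∘ (fun ω j => W (g j) ω); P]
      = cov[W (L₁ 1 • k), W (∑ j, L₂ (Pi.single j 1) • g j); P] := by
    rw [covariance, covariance, integral_congr_ae h1, integral_congr_ae h2]
    refine integral_congr_ae ?_
    filter_upwards [h1, h2] with ω e1 e2
    rw [e1, e2]
  rw [h3, hW.covariance_eq, inner_smul_left, inner_sum]
  simp [inner_smul_right, hg]

lemma integral_mul_eq [IsProbabilityMeasure P] (hW : IsIsonormal P W) {ι : Type*} [Fintype ι]
    {f : (ι → ℝ) → ℝ} (hf : ContDiff ℝ 1 f) {C C' : ℝ} (hC : ∀ y, |f y| ≤ C)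
    (hC' : ∀ y, ‖fderiv ℝ f y‖ ≤ C') (h : ι → H) (k : H) :
    ∫ ω, W k ω * f (fun j => W (h j) ω) ∂P
      = ∫ ω, fderiv ℝ f (fun j => W (h j) ω) (fun j => ⟪h j, k⟫) ∂P := by
  set a : ι → ℝ := fun j => ⟪h j, k⟫ / ‖k‖ ^ 2 with ha
  have hak : ‖k‖ ^ 2 • a = fun j => ⟪h j, k⟫ := by
    ext j
    rcases eq_or_ne k 0 with rfl | hk
    · simp
    · simp only [ha, Pi.smul_apply, smul_eq_mul]
      field_simp
  set g : ι → H := fun j => h j - a j • k with hg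
  set Z : Ω → ι → ℝ := fun ω j => W (g j) ω with hZ
  have hZm : AEMeasurable Z P := aemeasurable_pi_lambda _ fun j => hW.1 (g j)
  have hind : IndepFun (W k) Z P := by
    refine hW.indepFun_pi k g fun j => ?_
    have := congrFun hak j
    simp only [Pi.smul_apply, smul_eq_mul] at this
    rw [hg, inner_sub_right, inner_smul_right, real_inner_self_eq_norm_sq, real_inner_comm, ← this]
    ring
  have hX : (fun ω j => W (h j) ω) =ᵐ[P] fun ω => W k ω • a + Z ω := by
    have : ∀ j, W (h j) =ᵐ[P] fun ω => W k ω * a j + W (g j) ω := fun j => by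
      filter_upwards [hW.2.2.1 (a j • k) (g j), hW.2.2.2 (a j) k] with ω h1 h2
      have e : a j • k + g j = h j := by simp [hg]
      rw [e] at h1
      rw [h1, Pi.add_apply, h2]
      simp [mul_comm]
    filter_upwards [ae_all_iff.2 this] with ω hω
    ext j
    simp [hω j, hZ]
  have hmap := (indepFun_iff_map_prod_eq_prod_map_map (hW.1 k) hZm).1 hind
  have : IsProbabilityMeasure (P.map Z) := Measure.isProbabilityMeasure_map hZm
  rw [hW.2.1 k] at hmap
  have hpair : AEMeasurable (fun ω => (W k ω, Z ω)) P := (hW.1 k).prodMk hZm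
  have hfd : Continuous (fderiv ℝ f) := hf.continuous_fderiv one_ne_zero
  have hfc : Continuous f := hf.continuous
  have hint1 : Integrable (fun p : ℝ × (ι → ℝ) => p.1 * f (p.1 • a + p.2))
      ((gaussianReal 0 (‖k‖₊ ^ 2)).prod (P.map Z)) := by
    have h1 : Integrable (fun y : ℝ => y) (gaussianReal 0 (‖k‖₊ ^ 2)) :=
      (memLp_id_gaussianReal 1).integrable (by simp)
    exact (h1.comp_fst (P.map Z)).mul_bdd (c := C) (by fun_prop) (Eventually.of_forall fun p => hC _)
  have hint2 : Integrable (fun p : ℝ × (ι → ℝ) => fderiv ℝ f (p.1 • a + p.2) a)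
      ((gaussianReal 0 (‖k‖₊ ^ 2)).prod (P.map Z)) := by
    refine Integrable.of_bound (by fun_prop) (C' * ‖a‖) (Eventually.of_forall fun p => ?_)
    exact (fderiv ℝ f _).le_of_opNorm_le (hC' _) a
  calc ∫ ω, W k ω * f (fun j => W (h j) ω) ∂P
      = ∫ ω, W k ω * f (W k ω • a + Z ω) ∂P := by
        refine integral_congr_ae ?_
        filter_upwards [hX] with ω hω
        rw [hω]
    _ = ∫ p, p.1 * f (p.1 • a + p.2) ∂((gaussianReal 0 (‖k‖₊ ^ 2)).prod (P.map Z)) := by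
        rw [← hmap, integral_map hpair (by fun_prop)]
    _ = ∫ z, ∫ y, y * f (y • a + z) ∂gaussianReal 0 (‖k‖₊ ^ 2) ∂(P.map Z) :=
        integral_prod_symm _ hint1
    _ = ∫ z, ‖k‖ ^ 2 * ∫ y, fderiv ℝ f (y • a + z) a ∂gaussianReal 0 (‖k‖₊ ^ 2) ∂(P.map Z) := by
        congr 1 with z
        rw [integral_id_mul_gaussianReal (g := fun y => f (y • a + z))
          (g' := fun y => fderiv ℝ f (y • a + z) a) (C := C) (C' := C' * ‖a‖) ?_ (by fun_prop)
          (fun y => hC _) (fun y => (fderiv ℝ f _).le_of_opNorm_le (hC' _) a)]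
        · simp
        · intro y
          have h1 : HasDerivAt (fun y : ℝ => y • a + z) a y := by
            simpa using ((hasDerivAt_id y).smul_const a).add_const z
          exact ((hf.differentiable one_ne_zero _).hasFDerivAt).comp_hasDerivAt y h1
    _ = ‖k‖ ^ 2 * ∫ p, fderiv ℝ f (p.1 • a + p.2) a
          ∂((gaussianReal 0 (‖k‖₊ ^ 2)).prod (P.map Z)) := by
        rw [integral_const_mul, integral_prod_symm _ hint2]
    _ = ∫ ω, ‖k‖ ^ 2 * fderiv ℝ f (W k ω • a + Z ω) a ∂P := by
        rw [← hmap, integral_map hpair (by fun_prop), integral_const_mul]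
    _ = _ := by
        refine integral_congr_ae ?_
        filter_upwards [hX] with ω hω
        rw [hω, ← hak, map_smul, smul_eq_mul]

end IsIsonormal

/-- For every smooth `E`-valued random variable
`F = ∑_i f_i(W h₁, …, W h_n) ⊗ x_i ∈ S(Ω) ⊗ E` and every `k ∈ H`,
`E(DF(k)) = E(W(k) F)`, where `DF(k) = ∑_i ∑_j ∂_j f_i(W h₁,…,W h_n) ⟪h_j, k⟫ x_i`. -/
theorem clark_ocone_statement5 {Ω H E : Type*} [MeasurableSpace Ω]
    [NormedAddCommGroup H] [InnerProductSpace ℝ H] [CompleteSpace H]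
    [NormedAddCommGroup E] [NormedSpace ℝ E] [CompleteSpace E]
    (P : Measure Ω) [IsProbabilityMeasure P]
    (W : H → Ω → ℝ) (hW : IsIsonormal P W)
    (m n : ℕ) (f : Fin m → (Fin n → ℝ) → ℝ) (hf : ∀ i, CbSmooth (f i))
    (h : Fin n → H) (x : Fin m → E) (k : H) :
    ∫ ω, (∑ i, ∑ j, (fderiv ℝ (f i) (fun l => W (h l) ω) (Pi.single j 1) * ⟪h j, k⟫) • x i) ∂P
      = ∫ ω, W k ω • (∑ i, f i (fun l => W (h l) ω) • x i) ∂P := by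
  have hX : AEMeasurable (fun ω l => W (h l) ω) P := aemeasurable_pi_lambda _ fun l => hW.1 (h l)
  have hf1 : ∀ i, ContDiff ℝ 1 (f i) := fun i => (hf i).1.of_le (by exact_mod_cast le_top)
  have hfc : ∀ i, Continuous (f i) := fun i => (hf1 i).continuous
  have hfd : ∀ i, Continuous (fderiv ℝ (f i)) := fun i => (hf1 i).continuous_fderiv one_ne_zero
  have hb : ∀ i, ∃ C, ∀ y, |f i y| ≤ C := fun i => by simpa using (hf i).2 0
  have hb' : ∀ i, ∃ C, ∀ y, ‖fderiv ℝ (f i) y‖ ≤ C := fun i => by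
    simpa [norm_iteratedFDeriv_one] using (hf i).2 1
  choose C hC using hb
  choose C' hC' using hb'
  have hsum : ∀ i ω, ∑ j, fderiv ℝ (f i) (fun l => W (h l) ω) (Pi.single j 1) * ⟪h j, k⟫
      = fderiv ℝ (f i) (fun l => W (h l) ω) (fun j => ⟪h j, k⟫) := fun i ω =>
    ((fderiv ℝ (f i) _).apply_eq_sum_single_mul _).symm
  simp only [← Finset.sum_smul, hsum, Finset.smul_sum, smul_smul]
  rw [integral_finsetSum, integral_finsetSum]
  · refine Finset.sum_congr rfl fun i _ => ?_
    rw [integral_smul_const, integral_smul_const,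
      hW.integral_mul_eq (hf1 i) (hC i) (hC' i)]
  · intro i _
    refine Integrable.smul_const ?_ _
    exact (hW.hasGaussianLaw k).integrable.mul_bdd (c := C i)
      ((hfc i).measurable.comp_aemeasurable hX).aestronglyMeasurable
      (Eventually.of_forall fun ω => hC i _)
  · intro i _
    refine Integrable.smul_const ?_ _
    refine Integrable.of_bound ?_ (C' i * ‖fun j => ⟪h j, k⟫‖) (Eventually.of_forall fun ω =>
      (fderiv ℝ (f i) _).le_of_opNorm_le (hC' i _) _)
    exact (((hfd i).clm_apply continuous_const).measurable.comp_aemeasurable hX).aestronglyMeasurable
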